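/- Let 0 < α ≤ β, let f : ℝ → ℝ be differentiable, α-strongly convex, and β-smooth, let x* ∈ ℝ satisfy f'(x*) = 0, let δ > 0 and γ > 1, and let N be a natural number. Let x : ℕ → ℝ be a sequence with x_1 ≤ x* such that for every t < N, setting s_t = (f(x_t) − f(x_t − δ))/δ, we have −(1/β)·s_t ≥ (1 + γ)·δ and x_{t+1} = x_t − δ − (1/β)·s_t. Define h_t = f(x_t) − f(x*) and c = 1/(2β) − 1/((1 + γ)β). Then for all t ≤ N, h_{t+1} ≤ h_1 · exp(−2αc·t). -/

import Mathlib

/-- The Polyak–Łojasiewicz inequality for a strongly convex function on the line. -/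
theorem two_mul_gap_le_deriv_sq {α : ℝ} (hα : 0 < α) {f : ℝ → ℝ}
    (hsc : ∀ x y : ℝ, f y ≥ f x + deriv f x * (y - x) + α / 2 * (y - x) ^ 2) (x y : ℝ) :
    2 * α * (f x - f y) ≤ deriv f x ^ 2 := by
  have h := mul_le_mul_of_nonneg_left (hsc x y) hα.le
  nlinarith [sq_nonneg (deriv f x + α * (y - x))]

/-- Sufficient decrease of one lagged gradient step whose length is at least `γ * δ`. -/
theorem lagged_step_decrease {β : ℝ} (hβ : 0 < β) {f : ℝ → ℝ}
    (hconv : ∀ x y : ℝ, f x + deriv f x * (y - x) ≤ f y)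
    (hsm : ∀ x y : ℝ, f y ≤ f x + deriv f x * (y - x) + β / 2 * (y - x) ^ 2)
    {δ γ : ℝ} (hδ : 0 < δ) (hγ : 1 < γ) {x y : ℝ}
    (hs : -(1 / β) * ((f x - f (x - δ)) / δ) ≥ (1 + γ) * δ)
    (hy : y = x - δ - (1 / β) * ((f x - f (x - δ)) / δ)) :
    f y ≤ f x - (1 / (2 * β) - 1 / ((1 + γ) * β)) * deriv f x ^ 2 := by
  obtain ⟨p, hp⟩ : ∃ p, p = -(1 / β) * ((f x - f (x - δ)) / δ) := ⟨_, rfl⟩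
  obtain ⟨q, hq⟩ : ∃ q, q = -deriv f x / β := ⟨_, rfl⟩
  have hg : deriv f x = -(β * q) := by rw [hq]; field_simp
  have hfd : f (x - δ) = f x + β * δ * p := by rw [hp]; field_simp; ring
  have hβδ : 0 < β * δ := mul_pos hβ hδ
  rw [← hp] at hs
  have hyp : y - x = p - δ := by rw [hy, hp]; ring
  have hqp : q ≤ p := by
    have h := hconv x (x - δ)
    rw [hfd, hg] at h
    refine le_of_mul_le_mul_left ?_ hβδ
    linarith
  have hpq : p ≤ q + δ / 2 := by
    have h := hsm x (x - δ)
    rw [hfd, hg] at h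
    refine le_of_mul_le_mul_left ?_ hβδ
    linarith
  have hqδ : (1 + γ) / 2 * δ ^ 2 ≤ q ^ 2 := by
    have h1 : (1 / 2 + γ) * δ ≤ q := by linarith
    have h2 : ((1 / 2 + γ) * δ) ^ 2 ≤ q ^ 2 := pow_le_pow_left₀ (by positivity) h1 2
    nlinarith [sq_nonneg δ, mul_nonneg (sub_nonneg.2 hγ.le) (sq_nonneg δ),
      sq_nonneg (γ * δ - δ)]
  have hdev : (p - δ - q) ^ 2 ≤ δ ^ 2 := by
    apply sq_le_sq'
    all_goals linarith
  have hδq : δ ^ 2 / 2 ≤ q ^ 2 / (1 + γ) := by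
    rw [le_div_iff₀ (by linarith)]
    linarith
  have hc : (1 / (2 * β) - 1 / ((1 + γ) * β)) * deriv f x ^ 2
      = β * (q ^ 2 / 2 - q ^ 2 / (1 + γ)) := by
    have : 1 + γ ≠ 0 := by linarith
    rw [hg]; field_simp
  have h := hsm x y
  rw [hyp, hg] at h
  rw [hc]
  have h1 := mul_le_mul_of_nonneg_left hδq hβ.le
  have h2 := mul_le_mul_of_nonneg_left hdev hβ.le
  linarith

/-- Exponential convergence of noiseless Lagged Gradient
Descent: under the same iteration as in the monotonicity claim, the optimality
gap `h_t = f(x_t) - f(x*)` satisfies `h_{t+1} ≤ h_1 · exp(-2αc·t)` with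
`c = 1/(2β) - 1/((1+γ)β)`. -/
theorem lgd_noiseless_exponential_convergence
    (α β : ℝ) (hα : 0 < α) (hαβ : α ≤ β)
    (f : ℝ → ℝ) (hf : Differentiable ℝ f)
    (hsc : ∀ x y : ℝ, f y ≥ f x + deriv f x * (y - x) + α / 2 * (y - x) ^ 2)
    (hsm : ∀ x y : ℝ, f y ≤ f x + deriv f x * (y - x) + β / 2 * (y - x) ^ 2)
    (xs : ℝ) (hxs : deriv f xs = 0)
    (δ γ : ℝ) (hδ : 0 < δ) (hγ : 1 < γ)
    (N : ℕ) (x : ℕ → ℝ) (hx1 : x 1 ≤ xs)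
    (hstep : ∀ t : ℕ, 1 ≤ t → t < N →
      -(1 / β) * ((f (x t) - f (x t - δ)) / δ) ≥ (1 + γ) * δ ∧
      x (t + 1) = x t - δ - (1 / β) * ((f (x t) - f (x t - δ)) / δ))
    (c : ℝ) (hc : c = 1 / (2 * β) - 1 / ((1 + γ) * β)) :
    ∀ t : ℕ, 1 ≤ t → t < N →
      f (x (t + 1)) - f xs ≤ (f (x 1) - f xs) * Real.exp (-(2 * α * c * t)) := by
  have hβ : 0 < β := hα.trans_le hαβ
  have hconv : ∀ x y : ℝ, f x + deriv f x * (y - x) ≤ f y := fun x y => by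
    have := hsc x y
    have : 0 ≤ α / 2 * (y - x) ^ 2 := by positivity
    linarith
  have hc0 : 0 ≤ c := by
    rw [hc, sub_nonneg]
    apply one_div_le_one_div_of_le (by positivity)
    nlinarith
  have hgap : ∀ t : ℕ, 1 ≤ t → t < N →
      f (x (t + 1)) - f xs ≤ (f (x t) - f xs) * Real.exp (-(2 * α * c)) := by
    intro t ht htN
    obtain ⟨hs, hy⟩ := hstep t ht htN
    have hdec := lagged_step_decrease hβ hconv hsm hδ hγ hs hy
    rw [← hc] at hdec
    have hpl := mul_le_mul_of_nonneg_left (two_mul_gap_le_deriv_sq hα hsc (x t) xs) hc0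
    have hnonneg : 0 ≤ f (x t) - f xs := by
      have := hconv xs (x t)
      rw [hxs] at this
      linarith
    have hexp := mul_le_mul_of_nonneg_left (Real.add_one_le_exp (-(2 * α * c))) hnonneg
    linarith
  intro t ht
  induction t, ht using Nat.le_induction with
  | base =>
    intro htN
    simpa using hgap 1 le_rfl htN
  | succ t ht ih =>
    intro htN
    calc f (x (t + 1 + 1)) - f xs
        ≤ (f (x (t + 1)) - f xs) * Real.exp (-(2 * α * c)) := hgap (t + 1) (by omega) htN
      _ ≤ (f (x 1) - f xs) * Real.exp (-(2 * α * c * t)) * Real.exp (-(2 * α * c)) := by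
        gcongr
        exact ih (by omega)
      _ = (f (x 1) - f xs) * Real.exp (-(2 * α * c * (t + 1 : ℕ))) := by
        rw [mul_assoc, ← Real.exp_add]
        push_cast
        ring_nf
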